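/- Let A and B be topological spaces whose product M = A × B is a topological manifold, and let G ⊆ Homeo(M) be a subgroup satisfying property (*). Then for every Hausdorff group topology τ on G, the set G(B) = {f ∈ G : f({a} × B) = {a} × B for all a ∈ A} is a closed subgroup of (G, τ). -/

import Mathlib

/-- The group of self-homeomorphisms of a space, with `(f * g) x = f (g x)`. -/
instance Homeomorph.instGroupSelf {M : Type*} [TopologicalSpace M] : Group (Homeomorph M M) where
  mul f g := g.trans f
  one := Homeomorph.refl M
  inv := Homeomorph.symm
  mul_assoc f g h := Homeomorph.ext fun _ => rfl
  one_mul f := Homeomorph.ext fun _ => rfl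
  mul_one f := Homeomorph.ext fun _ => rfl
  inv_mul_cancel f := Homeomorph.ext fun x => f.symm_apply_apply x

/-- If `G` satisfies property (*), then every nonempty open set supports two elements of `G` which
do not commute. -/
theorem exists_not_commute_of_supported {M : Type*} [TopologicalSpace M] [T2Space M]
    {G : Subgroup (Homeomorph M M)}
    (hstar : ∀ U : Set M, IsOpen U → U.Nonempty → ∃ g ∈ G, g ≠ 1 ∧ ∀ x ∉ U, g x = x)
    {U : Set M} (hU : IsOpen U) (hne : U.Nonempty) :
    ∃ g ∈ G, ∃ h ∈ G, (∀ x ∉ U, g x = x) ∧ (∀ x ∉ U, h x = x) ∧ g * h ≠ h * g := by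
  obtain ⟨g, hgG, hg1, hgU⟩ := hstar U hU hne
  obtain ⟨x, hx⟩ : ∃ x, g x ≠ x := by
    by_contra! hall
    exact hg1 (Homeomorph.ext hall)
  have hxU : x ∈ U := by
    by_contra hxU
    exact hx (hgU x hxU)
  obtain ⟨P, Q, hP, hQ, hgP, hxQ, hPQ⟩ := t2_separation hx
  obtain ⟨h, hhG, hh1, hhW⟩ := hstar (U ∩ Q ∩ g ⁻¹' P)
    ((hU.inter hQ).inter (hP.preimage g.continuous)) ⟨x, ⟨hxU, hxQ⟩, hgP⟩
  refine ⟨g, hgG, h, hhG, hgU, fun y hy => hhW y fun hyW => hy hyW.1.1, fun hcomm => hh1 ?_⟩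
  refine Homeomorph.ext fun y => ?_
  change h y = y
  by_contra hy
  have hyW : y ∈ U ∩ Q ∩ g ⁻¹' P := by
    by_contra hyW
    exact hy (hhW y hyW)
  have hgy : h (g y) = g y :=
    hhW _ fun hmem => Set.disjoint_left.mp hPQ hyW.2 hmem.1.2
  have hcomm_y : g (h y) = h (g y) := congrArg (fun k : Homeomorph M M => k y) hcomm
  exact hy (g.injective (hcomm_y.trans hgy))

/-- For `f ∈ G`, where `G` satisfies property (*), the image under `f` of an open set `U` misses an
open set `V` if and only if the conjugates by `f` of the elements of `G` supported in `U` commute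
with the elements of `G` supported in `V`. -/
theorem mapsTo_compl_iff_forall_conj_commute {M : Type*} [TopologicalSpace M] [T2Space M]
    {G : Subgroup (Homeomorph M M)}
    (hstar : ∀ U : Set M, IsOpen U → U.Nonempty → ∃ g ∈ G, g ≠ 1 ∧ ∀ x ∉ U, g x = x)
    {U V : Set M} (hU : IsOpen U) (hV : IsOpen V) (f : G) :
    Set.MapsTo f.1 U Vᶜ ↔
      ∀ g h : G, (∀ x ∉ U, g.1 x = x) → (∀ x ∉ V, h.1 x = x) →
        f * g * f⁻¹ * h = h * (f * g * f⁻¹) := by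
  constructor
  · intro hf g h hg hh
    have hconj : ∀ x, f.1.symm x ∉ U → f.1 (g.1 (f.1.symm x)) = x := fun x hx => by
      rw [hg _ hx, Homeomorph.apply_symm_apply]
    refine Subtype.ext (Homeomorph.ext fun x => ?_)
    change f.1 (g.1 (f.1.symm (h.1 x))) = h.1 (f.1 (g.1 (f.1.symm x)))
    have hVU : ∀ y ∈ V, f.1.symm y ∉ U := fun y hy hyU =>
      hf hyU (by rwa [Homeomorph.apply_symm_apply])
    by_cases hx : x ∈ V
    · have hhx : h.1 x ∈ V := by
        by_contra hhx
        exact hhx (by rwa [h.1.injective (hh _ hhx)])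
      rw [hconj _ (hVU _ hx), hconj _ (hVU _ hhx)]
    · rw [hh x hx]
      by_cases hxU : f.1.symm x ∈ U
      · have hgU : g.1 (f.1.symm x) ∈ U := by
          by_contra hgU
          exact hgU (by rwa [g.1.injective (hg _ hgU)])
        rw [hh _ (hf hgU)]
      · rw [hconj x hxU, hh x hx]
  · intro hcomm x hxU hxV
    obtain ⟨k, hkG, h, hhG, hk, hh, hkh⟩ := exists_not_commute_of_supported hstar
      ((hU.preimage f.1.symm.continuous).inter hV)
      ⟨f.1 x, by simpa using hxU, hxV⟩
    have hconj : f * (f⁻¹ * ⟨k, hkG⟩ * f) * f⁻¹ = ⟨k, hkG⟩ := by group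
    have hc := hcomm (f⁻¹ * ⟨k, hkG⟩ * f) ⟨h, hhG⟩ (fun y hy => ?_)
      (fun y hy => hh y fun hmem => hy hmem.2)
    · rw [hconj] at hc
      exact hkh (congrArg Subtype.val hc)
    · change f.1.symm (k (f.1 y)) = y
      rw [hk _ fun hmem => hy (by simpa using hmem.1), Homeomorph.symm_apply_apply]

/-- If `G` satisfies property (*), then sending one open set into the complement of another is a
closed condition in every Hausdorff group topology on `G`. -/
theorem isClosed_setOf_mapsTo_compl {M : Type*} [TopologicalSpace M] [T2Space M]
    {G : Subgroup (Homeomorph M M)}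
    (hstar : ∀ U : Set M, IsOpen U → U.Nonempty → ∃ g ∈ G, g ≠ 1 ∧ ∀ x ∉ U, g x = x)
    [TopologicalSpace G] [IsTopologicalGroup G] [T2Space G]
    {U V : Set M} (hU : IsOpen U) (hV : IsOpen V) :
    IsClosed {f : G | Set.MapsTo f.1 U Vᶜ} := by
  simp only [mapsTo_compl_iff_forall_conj_commute hstar hU hV, Set.ofPred_forall]
  exact isClosed_iInter fun g => isClosed_iInter fun h => isClosed_iInter fun _ =>
    isClosed_iInter fun _ => isClosed_eq (by fun_prop) (by fun_prop)

/-- A self-map of `A × B`, where `A × B` is Hausdorff, preserves the first coordinate if and only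
if it sends `U × B` into the complement of `V × B` for all disjoint open `U` and `V` in `A`. -/
theorem forall_fst_eq_iff_mapsTo_compl {A B : Type*} [TopologicalSpace A] [TopologicalSpace B]
    [T2Space (A × B)] (f : A × B → A × B) :
    (∀ x, (f x).1 = x.1) ↔
      ∀ U V : Set A, IsOpen U → IsOpen V → Disjoint U V →
        Set.MapsTo f (Prod.fst ⁻¹' U) (Prod.fst ⁻¹' V)ᶜ := by
  constructor
  · intro hf U V _ _ hUV x hxU hxV
    exact Set.disjoint_left.mp hUV hxU (by simpa only [Set.mem_preimage, hf x] using hxV)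
  · intro hf x
    by_contra hx
    have : T2Space A := .of_injective_continuous (f := fun a : A => (a, x.2))
      (fun _ _ hab => congrArg Prod.fst hab) (by fun_prop)
    obtain ⟨V, U, hV, hU, hfV, hxU, hVU⟩ := t2_separation hx
    exact hf U V hU hV hVU.symm hxU hfV

/-- A bijection of `A × B` maps each fiber `{a} × B` onto itself if and only if it preserves the
first coordinate. -/
theorem forall_image_fiber_eq_iff {A B : Type*} {f : A × B → A × B}
    (hf : Function.Surjective f) :
    (∀ a : A, f '' ({a} ×ˢ (Set.univ : Set B)) = {a} ×ˢ (Set.univ : Set B)) ↔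
      ∀ x, (f x).1 = x.1 := by
  constructor
  · intro h x
    have hx : f x ∈ ({x.1} ×ˢ (Set.univ : Set B) : Set (A × B)) := by
      rw [← h x.1]
      exact ⟨x, by simp, rfl⟩
    simpa using hx
  · intro h a
    ext y
    constructor
    · rintro ⟨x, hx, rfl⟩
      simpa [h x] using hx
    · intro hy
      obtain ⟨x, rfl⟩ := hf y
      exact ⟨x, by simpa [h x] using hy, rfl⟩

/-- The subgroup of those elements of `G` which preserve the first coordinate. -/
def fstPreservingSubgroup {A B : Type*} [TopologicalSpace A] [TopologicalSpace B]
    (G : Subgroup (Homeomorph (A × B) (A × B))) : Subgroup G where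
  carrier := {f | ∀ x, (f.1 x).1 = x.1}
  mul_mem' {f g} hf hg x := (hf (g.1 x)).trans (hg x)
  one_mem' _ := rfl
  inv_mem' {f} hf x := by
    change (f.1.symm x).1 = x.1
    rw [← hf, Homeomorph.apply_symm_apply]

/-- Let `M = A × B` be a product which is a topological manifold, and let `G ⊆ Homeo(M)` be
a subgroup satisfying property (*).  For any Hausdorff group topology on `G`, the set
`G(B) = {f ∈ G : f({a} × B) = {a} × B for all a ∈ A}` is a closed subgroup of `G`. -/
theorem fiber_preserving_closed_subgroup
    {n : ℕ} {A B : Type*} [TopologicalSpace A] [TopologicalSpace B]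
    [T2Space (A × B)] [ChartedSpace (EuclideanSpace ℝ (Fin n)) (A × B)]
    (G : Subgroup (Homeomorph (A × B) (A × B)))
    (hstar : ∀ U : Set (A × B), IsOpen U → U.Nonempty →
      ∃ g ∈ G, g ≠ 1 ∧ ∀ x ∉ U, g x = x)
    [τ : TopologicalSpace G] [IsTopologicalGroup G] [T2Space G] :
    ∃ H : Subgroup G,
      (H : Set G) = {f : G | ∀ a : A,
          ⇑(f : Homeomorph (A × B) (A × B)) '' ({a} ×ˢ (Set.univ : Set B)) =
            {a} ×ˢ (Set.univ : Set B)} ∧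
      IsClosed (H : Set G) := by
  refine ⟨fstPreservingSubgroup G, ?_, ?_⟩
  · ext f
    exact (forall_image_fiber_eq_iff f.1.surjective).symm
  · change IsClosed {f : G | ∀ x, (f.1 x).1 = x.1}
    simp only [forall_fst_eq_iff_mapsTo_compl, Set.ofPred_forall]
    exact isClosed_iInter fun U => isClosed_iInter fun V => isClosed_iInter fun hU =>
      isClosed_iInter fun hV => isClosed_iInter fun _ =>
        isClosed_setOf_mapsTo_compl hstar (hU.preimage continuous_fst) (hV.preimage continuous_fst)
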